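/- Let G be a locally triangle-free graph in W₂ with α(G) ≥ 3 that is not a join of two proper subgraphs. Then for every edge ab of G that lies in a triangle, the graph G_{ab} = G \ N_G[{a,b}] is nonempty and α(G_{ab}) = α(G) − 1. -/

import Mathlib

open Set

variable {V : Type*}

/-- `S` is an independent set of `G` contained in the vertex subset `W`
(i.e. an independent set of the induced subgraph `G[W]`). -/
def IsIndepOn (G : SimpleGraph V) (W S : Set V) : Prop :=
  S ⊆ W ∧ ∀ ⦃x⦄, x ∈ S → ∀ ⦃y⦄, y ∈ S → ¬ G.Adj x y

/-- `S` is a maximal independent set of the induced subgraph `G[W]`. -/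
def MaxIndepOn (G : SimpleGraph V) (W : Set V) (S : Finset V) : Prop :=
  IsIndepOn G W ↑S ∧ ∀ v ∈ W, v ∉ S → ¬ IsIndepOn G W (insert v ↑S)

/-- The independence number of the induced subgraph `G[W]`. -/
noncomputable def indepNumOn (G : SimpleGraph V) (W : Set V) : ℕ :=
  sSup {n | ∃ S : Finset V, IsIndepOn G W ↑S ∧ S.card = n}

/-- The induced subgraph `G[W]` is well-covered: every maximal independent set
has cardinality equal to the independence number. -/
def WellCoveredOn (G : SimpleGraph V) (W : Set V) : Prop :=
  ∀ S : Finset V, MaxIndepOn G W S → S.card = indepNumOn G W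

/-- The independence number `α(G)`. -/
noncomputable def indepNum (G : SimpleGraph V) : ℕ := indepNumOn G Set.univ

/-- `G` is well-covered. -/
def WellCovered (G : SimpleGraph V) : Prop := WellCoveredOn G Set.univ

/-- The induced subgraph `G[W]` has no isolated vertices. -/
def NoIsolatedOn (G : SimpleGraph V) (W : Set V) : Prop :=
  ∀ v ∈ W, ∃ u ∈ W, G.Adj v u

/-- The induced subgraph `G[W]` is in the class `W₂`: it has no isolated
vertices, is well-covered, and removing any vertex leaves a well-covered graph
with the same independence number. -/
def W2On (G : SimpleGraph V) (W : Set V) : Prop :=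
  NoIsolatedOn G W ∧ WellCoveredOn G W ∧
    ∀ v ∈ W, WellCoveredOn G (W \ {v}) ∧ indepNumOn G (W \ {v}) = indepNumOn G W

/-- `G` is in the class `W₂`. -/
def W2 (G : SimpleGraph V) : Prop := W2On G Set.univ

/-- The closed neighborhood `N_G[S]` of a set of vertices `S`. -/
def nbhd (G : SimpleGraph V) (S : Set V) : Set V :=
  {v | v ∈ S ∨ ∃ u ∈ S, G.Adj u v}

/-- The vertex set of `G_S = G \ N_G[S]`. -/
def GDel (G : SimpleGraph V) (S : Set V) : Set V := Set.univ \ nbhd G S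

/-- The induced subgraph `G[W]` is triangle-free. -/
def TriangleFreeOn (G : SimpleGraph V) (W : Set V) : Prop :=
  ∀ x ∈ W, ∀ y ∈ W, ∀ z ∈ W, ¬ (G.Adj x y ∧ G.Adj y z ∧ G.Adj x z)

/-- `G` is locally triangle-free: `G_v` is triangle-free for every vertex `v`. -/
def LocallyTriangleFree (G : SimpleGraph V) : Prop :=
  ∀ v : V, TriangleFreeOn G (GDel G {v})

/-- `G` is a join of two proper (nonempty, disjoint) subgraphs. -/
def IsJoin (G : SimpleGraph V) : Prop :=
  ∃ V₁ V₂ : Set V, V₁.Nonempty ∧ V₂.Nonempty ∧ Disjoint V₁ V₂ ∧ V₁ ∪ V₂ = Set.univ ∧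
    ∀ x ∈ V₁, ∀ y ∈ V₂, G.Adj x y

/-! ### Independent sets -/

lemma IsIndepOn.card_le [Fintype V] {G : SimpleGraph V} {W : Set V} {S : Finset V}
    (h : IsIndepOn G W ↑S) : S.card ≤ indepNumOn G W :=
  le_csSup ⟨Fintype.card V, by rintro n ⟨T, -, rfl⟩; exact T.card_le_univ⟩ ⟨S, h, rfl⟩

lemma IsIndepOn.exists_maxIndepOn [Fintype V] {G : SimpleGraph V} {W : Set V} {S : Finset V}
    (h : IsIndepOn G W ↑S) : ∃ T : Finset V, S ⊆ T ∧ MaxIndepOn G W T := by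
  classical
  obtain ⟨T, hST, hT⟩ :=
    (Set.toFinite {T : Finset V | IsIndepOn G W ↑T}).exists_le_maximal (a := S) h
  refine ⟨T, hST, hT.prop, fun v _ hvT hv => hvT ?_⟩
  rw [← Finset.coe_insert] at hv
  exact hT.le_of_ge hv (Finset.subset_insert v T) (Finset.mem_insert_self v T)

lemma IsIndepOn.insert {G : SimpleGraph V} {W S : Set V} (h : IsIndepOn G W S) {v : V}
    (hvW : v ∈ W) (hv : ∀ s ∈ S, ¬ G.Adj v s) : IsIndepOn G W (insert v S) := by
  refine ⟨Set.insert_subset hvW h.1, ?_⟩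
  rintro x (rfl | hx) y (rfl | hy)
  · exact G.irrefl
  · exact hv y hy
  · exact fun hxy => hv x hx hxy.symm
  · exact h.2 hx hy

lemma mem_GDel_singleton {G : SimpleGraph V} {v x : V} :
    x ∈ GDel G {v} ↔ x ≠ v ∧ ¬ G.Adj v x := by
  simp [GDel, nbhd]

lemma mem_GDel_pair {G : SimpleGraph V} {a b x : V} :
    x ∈ GDel G {a, b} ↔ (x ≠ a ∧ x ≠ b) ∧ ¬ G.Adj a x ∧ ¬ G.Adj b x := by
  simp [GDel, nbhd]

/-- In a graph in `W₂`, a vertex outside `N[S]`, `S` independent, is not isolated in `G_S`. -/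
lemma W2.exists_adj [Fintype V] {G : SimpleGraph V} (h2 : W2 G) {S : Set V}
    (hS : IsIndepOn G univ S) {v : V} (hvS : v ∉ S) (hv : ∀ s ∈ S, ¬ G.Adj v s) :
    ∃ u, G.Adj v u ∧ ∀ s ∈ S, ¬ G.Adj u s := by
  classical
  by_contra! hcon
  have hS' : IsIndepOn G (univ \ {v}) ↑S.toFinite.toFinset := by
    refine ⟨fun x hx => ⟨trivial, ?_⟩, fun x hx y hy => hS.2 (by simpa using hx) (by simpa using hy)⟩
    rintro rfl
    exact hvS (by simpa using hx)
  obtain ⟨T, hST, hT⟩ := hS'.exists_maxIndepOn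
  have hvT : v ∉ T := fun h => (hT.1.1 h).2 rfl
  have hins : IsIndepOn G univ ↑(insert v T) := by
    rw [Finset.coe_insert]
    refine IsIndepOn.insert ⟨subset_univ _, hT.1.2⟩ trivial fun t ht hvt => ?_
    obtain ⟨s, hs, hts⟩ := hcon t hvt
    exact hT.1.2 ht (hST (by simpa using hs)) hts
  have hle := hins.card_le
  have hv2 := h2.2.2 v trivial
  rw [Finset.card_insert_of_notMem hvT, ← hv2.2, ← hv2.1 T hT] at hle
  omega

/-- In a locally triangle-free graph in `W₂`, if an edge `ab` is not dominating, then a maximal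
independent set of `G_{ab}` becomes a maximal independent set of `G` by adding `a`. -/
lemma mem_of_maxIndepOn_of_not_adj [Fintype V] {G : SimpleGraph V} (h2 : W2 G)
    (hloc : LocallyTriangleFree G) {a b : V} (hab : G.Adj a b) {S : Finset V}
    (hS : MaxIndepOn G (GDel G {a, b}) S) (hne : S.Nonempty) {w : V} (hwa : w ≠ a)
    (hwS : ∀ s ∈ S, ¬ G.Adj w s) (hw : ¬ G.Adj w a) : w ∈ S := by
  by_contra hwnS
  obtain ⟨v, hv⟩ := hne
  have hSab : ∀ s ∈ S, (s ≠ a ∧ s ≠ b) ∧ ¬ G.Adj a s ∧ ¬ G.Adj b s :=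
    fun s hs => mem_GDel_pair.1 (hS.1.1 hs)
  have hdom : ∀ u, u ∉ S → (∀ s ∈ S, ¬ G.Adj u s) → u ≠ a → u ≠ b → G.Adj a u ∨ G.Adj b u := by
    intro u hu huS hua hub
    by_contra! h
    have hmem : u ∈ GDel G {a, b} := mem_GDel_pair.2 ⟨⟨hua, hub⟩, h⟩
    exact hS.2 u hmem hu (hS.1.insert hmem huS)
  have htf : ∀ x y z, x ∉ S → y ∉ S → z ∉ S → (∀ s ∈ S, ¬ G.Adj x s) → (∀ s ∈ S, ¬ G.Adj y s) →
      (∀ s ∈ S, ¬ G.Adj z s) → G.Adj x y → G.Adj y z → ¬ G.Adj x z := by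
    intro x y z hx hy hz hxS hyS hzS hxy hyz hxz
    refine hloc v x ?_ y ?_ z ?_ ⟨hxy, hyz, hxz⟩ <;> rw [mem_GDel_singleton] <;>
      grind [SimpleGraph.adj_comm]
  have haS : a ∉ S := fun h => (hSab a h).1.1 rfl
  have hbS : b ∉ S := fun h => (hSab b h).1.2 rfl
  have hbw : G.Adj b w := by
    have := hdom w hwnS hwS hwa (by rintro rfl; exact hw hab.symm)
    grind [SimpleGraph.adj_comm]
  -- the neighbours of `a` in `G_S`, other than `b`
  let X : Set V := {x | G.Adj a x ∧ x ∉ S ∧ (∀ s ∈ S, ¬ G.Adj x s) ∧ x ≠ b}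
  have hSX : IsIndepOn G univ (↑S ∪ X) := by
    refine ⟨subset_univ _, ?_⟩
    have hS2 := hS.1.2
    rintro x (hx | hx) y (hy | hy)
    · exact hS2 hx hy
    · exact fun h => hy.2.2.1 x hx h.symm
    · exact hx.2.2.1 y hy
    · intro h
      exact htf x a y hx.2.1 haS hy.2.1 hx.2.2.1 (fun s hs => (hSab s hs).2.1) hy.2.2.1
        hx.1.symm hy.1 h
  obtain ⟨u, hbu, hu⟩ := h2.exists_adj hSX (v := b)
    (by rintro (h | h); exacts [hbS h, h.2.2.2 rfl])
    (by
      rintro s (hs | hs)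
      · exact (hSab s hs).2.2
      · intro h
        exact htf a b s haS hbS hs.2.1 (fun s hs => (hSab s hs).2.1) (fun s hs => (hSab s hs).2.2)
          hs.2.2.1 hab h hs.1)
  have huS : u ∉ S := fun h => (hSab u h).2.2 hbu
  have huS' : ∀ s ∈ S, ¬ G.Adj u s := fun s hs => hu s (Or.inl hs)
  have hleaf : ∀ z, z ≠ u → z ∉ S → (∀ s ∈ S, ¬ G.Adj z s) → G.Adj b z → False := by
    intro z hzu hzS hzS' hbz
    have huz : ¬ G.Adj u z := fun h =>
      htf u z b huS hzS hbS huS' hzS' (fun s hs => (hSab s hs).2.2) h hbz.symm hbu.symm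
    obtain ⟨t, hut, ht⟩ := h2.exists_adj (S := insert z ↑S) (v := u)
      (IsIndepOn.insert ⟨subset_univ _, hS.1.2⟩ trivial hzS')
      (by rintro (h | h); exacts [hzu h.symm, huS h])
      (by rintro s (rfl | hs); exacts [huz, huS' s hs])
    have htS' : ∀ s ∈ S, ¬ G.Adj t s := fun s hs => ht s (Or.inr hs)
    have htS : t ∉ S := fun h => huS' t h hut
    have htz := ht z (Or.inl rfl)
    have htb : t ≠ b := by rintro rfl; exact htz hbz
    have hbt : ¬ G.Adj b t := fun h =>
      htf b u t hbS huS htS (fun s hs => (hSab s hs).2.2) huS' htS' hbu hut h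
    have hta : t ≠ a := by rintro rfl; exact hbt hab.symm
    have hat : G.Adj a t := (hdom t htS htS' hta htb).resolve_right hbt
    exact hu t (Or.inr ⟨hat, htS, htS', htb⟩) hut
  by_cases hua : u = a
  · exact hleaf w (by rintro rfl; exact hwa hua) hwnS hwS hbw
  · exact hleaf a (Ne.symm hua) haS (fun s hs => (hSab s hs).2.1) hab.symm

/-! ### Vertices far apart in the complement graph -/

section Complement

variable {H : SimpleGraph V}

/-- For every clique `S` of `H` and every vertex `v` adjacent to all of `S`, some other vertex
adjacent to all of `S` is not adjacent to `v`. -/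
def CliqueExchange (H : SimpleGraph V) : Prop :=
  ∀ (S : Set V) (v : V), H.IsClique S → (∀ s ∈ S, H.Adj v s) →
    ∃ u, u ≠ v ∧ ¬ H.Adj u v ∧ ∀ s ∈ S, H.Adj u s

/-- No neighbourhood of `H` contains three pairwise nonadjacent vertices. -/
def ClawFree (H : SimpleGraph V) : Prop :=
  ∀ v x y z, H.Adj v x → H.Adj v y → H.Adj v z → x ≠ y → y ≠ z → x ≠ z →
    H.Adj x y ∨ H.Adj y z ∨ H.Adj x z

/-- If `a`, `b` are nonadjacent without common neighbour and some edge joins their neighbourhoods,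
then a neighbour of `b` has no neighbour outside the closed neighbourhoods of `a` and `b`. -/
lemma ClawFree.neighbor_cases (hcf : ClawFree H) (hex : CliqueExchange H)
    (hedge : ∀ p q, H.Adj p q → ∃ r, H.Adj p r ∧ H.Adj q r) {a b : V}
    (hnab : ¬ H.Adj a b) (hdisj : ∀ z, H.Adj a z → ¬ H.Adj b z)
    {x y : V} (hx : H.Adj b x) (hy : H.Adj a y) (hxy : H.Adj x y)
    {x' z : V} (hx' : H.Adj b x') (hz : H.Adj x' z) : z = b ∨ H.Adj a z ∨ H.Adj b z := by
  by_contra! hC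
  obtain ⟨hzb, haz, hbz⟩ := hC
  -- outside the closed neighbourhood of `b`, a neighbour of `b` sees a clique
  have hclique : ∀ p q r, H.Adj b p → H.Adj p q → H.Adj p r → ¬ H.Adj b q → ¬ H.Adj b r →
      q ≠ b → r ≠ b → q ≠ r → H.Adj q r := by
    intro p q r hbp hpq hpr hbq hbr hqb hrb hqr
    have := hcf p b q r hbp.symm hpq hpr (Ne.symm hqb) hqr (Ne.symm hrb)
    tauto
  have hclique' : ∀ p q r, H.Adj a p → H.Adj p q → H.Adj p r → ¬ H.Adj a q → ¬ H.Adj a r →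
      q ≠ a → r ≠ a → q ≠ r → H.Adj q r := by
    intro p q r hap hpq hpr haq har hqa hra hqr
    have := hcf p a q r hap.symm hpq hpr (Ne.symm hqa) hqr (Ne.symm hra)
    tauto
  have hna : ∀ p, H.Adj b p → ∀ q, H.Adj p q → q ≠ a := by
    rintro p hp q hpq rfl
    exact hdisj p hpq.symm hp
  have hnb : ∀ p, H.Adj a p → ∀ q, H.Adj p q → q ≠ b := by
    rintro p hp q hpq rfl
    exact hdisj p hp hpq.symm
  have hmixed : ∀ p q r, H.Adj b p → H.Adj a q → H.Adj p q → H.Adj p r → r ≠ b → ¬ H.Adj a r →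
      ¬ H.Adj b r → False := by
    intro p q r hbp haq hpq hpr hrb har hbr
    have hqr : H.Adj q r := hclique p q r hbp hpq hpr (hdisj q haq) hbr
      (by rintro rfl; exact hnab haq) hrb (by rintro rfl; exact har haq)
    obtain ⟨u, hur, hnur, hu⟩ := hex {p, q} r
      (by
        rw [SimpleGraph.isClique_pair]
        exact fun _ => hpq)
      (by rintro s (rfl | rfl); exacts [hpr.symm, hqr.symm])
    have hup := hu p (Or.inl rfl)
    have huq := hu q (Or.inr rfl)
    by_cases hbu : H.Adj b u
    · exact hnur (hclique' q u r haq huq.symm hqr (fun h => hdisj u h hbu) har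
        (hna p hbp u hup.symm) (hna p hbp r hpr) hur)
    · exact hnur (hclique p u r hbp hup.symm hpr hbu hbr (hnb q haq u huq.symm) hrb hur)
  have hshare : ∀ p q, H.Adj b p → H.Adj b q → H.Adj p q → (∃ r, H.Adj a r ∧ H.Adj p r) →
      ∃ r, H.Adj a r ∧ H.Adj q r := by
    rintro p q hbp hbq hpq ⟨r, har, hpr⟩
    obtain ⟨u, hub, hnub, hu⟩ := hex {p, q} b
      (by rw [SimpleGraph.isClique_pair]; exact fun _ => hpq)
      (by rintro s (rfl | rfl); exacts [hbp, hbq])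
    have hup := hu p (Or.inl rfl)
    refine ⟨u, ?_, (hu q (Or.inr rfl)).symm⟩
    by_contra hau
    exact hmixed p r u hbp har hpr hup.symm hub hau (fun h => hnub h.symm)
  let Q : Set V := {p | H.Adj b p ∧ ∃ r, H.Adj a r ∧ H.Adj p r}
  have hxQ : x ∈ Q := ⟨hx, y, hy, hxy⟩
  have hx'Q : x' ∉ Q := fun ⟨_, r, har, hr⟩ => hmixed x' r z hx' har hr hz hzb haz hbz
  have hQ : ∀ p ∈ Q, ∀ q, H.Adj b q → H.Adj p q → q ∈ Q := fun p hp q hbq hpq =>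
    ⟨hbq, hshare p q hp.1 hbq hpq hp.2⟩
  have hQclique : ∀ p ∈ Q, ∀ q ∈ Q, p ≠ q → H.Adj p q := by
    intro p hp q hq hpq
    rcases hcf b p q x' hp.1 hq.1 hx' hpq (by rintro rfl; exact hx'Q hq)
      (by rintro rfl; exact hx'Q hp) with h | h | h
    · exact h
    · exact absurd (hQ q hq x' hx' h) hx'Q
    · exact absurd (hQ p hp x' hx' h) hx'Q
  obtain ⟨q, hbq, hxq⟩ := hedge b x hx
  have hqQ : q ∈ Q := hQ x hxQ q hbq hxq
  obtain ⟨u, hux, hnux, hu⟩ := hex (insert b (Q \ {x})) x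
    (by
      rintro p (rfl | hp) q (rfl | hq) hpq
      · exact absurd rfl hpq
      · exact hq.1.1
      · exact hp.1.1.symm
      · exact hQclique p hp.1 q hq.1 hpq)
    (by
      rintro s (rfl | hs)
      · exact hx.symm
      · exact hQclique x hxQ s hs.1 (Ne.symm hs.2))
  have huq : H.Adj u q := hu q (Or.inr ⟨hqQ, hxq.ne'⟩)
  have huQ : u ∈ Q := hQ q hqQ u (hu b (Or.inl rfl)).symm huq.symm
  exact hnux (hQclique u huQ x hxQ hux)

/-- In a connected graph as above, two nonadjacent vertices lying in an independent triple have a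
common neighbour. -/
lemma ClawFree.exists_common_neighbor (hcf : ClawFree H) (hex : CliqueExchange H)
    (hedge : ∀ p q, H.Adj p q → ∃ r, H.Adj p r ∧ H.Adj q r)
    (hconn : ∀ W : Set V, W.Nonempty → (∀ x ∈ W, ∀ y, H.Adj x y → y ∈ W) → W = univ)
    {a b c : V} (hab : a ≠ b) (hnab : ¬ H.Adj a b) (hca : c ≠ a) (hcb : c ≠ b)
    (hac : ¬ H.Adj a c) (hbc : ¬ H.Adj b c) : ∃ z, H.Adj a z ∧ H.Adj b z := by
  by_contra! hdisj
  let F : Set V := {v | a ≠ v ∧ ¬ H.Adj a v ∧ (∀ z, H.Adj a z → ¬ H.Adj v z) ∧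
    ∃ c, c ≠ a ∧ c ≠ v ∧ ¬ H.Adj a c ∧ ¬ H.Adj v c}
  have hF : F = univ := by
    refine hconn F ⟨b, hab, hnab, hdisj, c, hca, hcb, hac, hbc⟩ ?_
    rintro v ⟨hav, hnav, hd, d, hda, hdv, had, hvd⟩ x hvx
    have hd' : ∀ z, H.Adj v z → ¬ H.Adj a z := fun z h h' => hd z h' h
    have hno : ∀ z, H.Adj a z → ¬ H.Adj x z := by
      intro z haz hxz
      have hW : ({a, v} ∪ {w | H.Adj a w ∨ H.Adj v w} : Set V) = univ := by
        refine hconn _ ⟨a, Or.inl (Or.inl rfl)⟩ ?_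
        rintro p ((rfl | rfl) | hp | hp) q hpq
        · exact Or.inr (Or.inl hpq)
        · exact Or.inr (Or.inr hpq)
        · rcases hcf.neighbor_cases hex hedge (fun h => hnav h.symm) hd' haz hvx hxz.symm hp hpq with h | h | h
          · exact Or.inl (Or.inl h)
          · exact Or.inr (Or.inr h)
          · exact Or.inr (Or.inl h)
        · rcases hcf.neighbor_cases hex hedge hnav hd hvx haz hxz hp hpq with h | h | h
          · exact Or.inl (Or.inr h)
          · exact Or.inr (Or.inl h)
          · exact Or.inr (Or.inr h)
      rcases hW.ge (mem_univ d) with (h | h) | h | h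
      exacts [hda h, hdv h, had h, hvd h]
    obtain ⟨u, hux, hnux, hu⟩ := hex {v} x (SimpleGraph.isClique_singleton v)
      (by rintro s rfl; exact hvx.symm)
    have huv : H.Adj u v := hu v rfl
    refine ⟨?_, fun h => hd x h hvx, hno, u, ?_, hux, fun h => hd u h huv.symm,
      fun h => hnux h.symm⟩
    · rintro rfl
      exact hnav hvx.symm
    · rintro rfl
      exact hnav huv
  exact (hF.ge (mem_univ a)).1 rfl

end Complement

/-! ### The complement of a locally triangle-free graph in `W₂` -/

lemma isIndepOn_univ_of_isClique_compl {G : SimpleGraph V} {S : Set V} (h : Gᶜ.IsClique S) :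
    IsIndepOn G univ S :=
  ⟨subset_univ _, fun _ hx _ hy hxy => (h hx hy hxy.ne).2 hxy⟩

lemma W2.cliqueExchange_compl [Fintype V] {G : SimpleGraph V} (h2 : W2 G) :
    CliqueExchange Gᶜ := by
  intro S v hS hv
  obtain ⟨u, hvu, hu⟩ := h2.exists_adj (isIndepOn_univ_of_isClique_compl hS)
    (fun h => (hv v h).1 rfl) (fun s hs => (hv s hs).2)
  refine ⟨u, hvu.ne', fun h => h.2 hvu.symm, fun s hs => ⟨?_, hu s hs⟩⟩
  rintro rfl
  exact (hv u hs).2 hvu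

lemma LocallyTriangleFree.clawFree_compl {G : SimpleGraph V} (h : LocallyTriangleFree G) :
    ClawFree Gᶜ := by
  intro v x y z hx hy hz hxy hyz hxz
  have := h v x (mem_GDel_singleton.2 ⟨hx.1.symm, hx.2⟩) y
    (mem_GDel_singleton.2 ⟨hy.1.symm, hy.2⟩) z (mem_GDel_singleton.2 ⟨hz.1.symm, hz.2⟩)
  simp only [SimpleGraph.compl_adj]
  tauto

lemma WellCovered.exists_common_nonneighbor [Fintype V] {G : SimpleGraph V} (h : WellCovered G)
    (hα : 3 ≤ indepNum G) {p q : V} (hpq : Gᶜ.Adj p q) : ∃ r, Gᶜ.Adj p r ∧ Gᶜ.Adj q r := by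
  classical
  have hS : IsIndepOn G univ ↑({p, q} : Finset V) := by
    apply isIndepOn_univ_of_isClique_compl
    rw [Finset.coe_pair, SimpleGraph.isClique_pair]
    exact fun _ => hpq
  obtain ⟨T, hST, hT⟩ := hS.exists_maxIndepOn
  have hcard : ({p, q} : Finset V).card < T.card := by
    have : T.card = indepNum G := h T hT
    have := Finset.card_le_two (a := p) (b := q)
    omega
  obtain ⟨r, hrT, hr⟩ := Finset.exists_mem_notMem_of_card_lt_card hcard
  simp only [Finset.mem_insert, Finset.mem_singleton, not_or] at hr
  exact ⟨r, ⟨Ne.symm hr.1, hT.1.2 (hST (by simp)) hrT⟩,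
    ⟨Ne.symm hr.2, hT.1.2 (hST (by simp)) hrT⟩⟩

lemma eq_univ_of_not_isJoin {G : SimpleGraph V} (h : ¬ IsJoin G) {W : Set V} (hW : W.Nonempty)
    (hcl : ∀ x ∈ W, ∀ y, Gᶜ.Adj x y → y ∈ W) : W = univ := by
  by_contra hne
  refine h ⟨W, Wᶜ, hW, nonempty_compl.2 hne, disjoint_compl_right, union_compl_self W, ?_⟩
  intro x hx y hy
  by_contra hxy
  exact hy (hcl x hx y ⟨by rintro rfl; exact hy hx, hxy⟩)

/-- If `G` is locally triangle-free in `W₂`, `α(G) ≥ 3` and `G` is not a join,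
then for every edge `ab` lying in a triangle, `G_{ab}` is nonempty and
`α(G_{ab}) = α(G) - 1`. -/
theorem stmt_13 [Fintype V] (G : SimpleGraph V) (h2 : W2 G)
    (hloc : LocallyTriangleFree G) (hα : 3 ≤ indepNum G) (hjoin : ¬ IsJoin G)
    {a b : V} (hab : G.Adj a b) (htri : ∃ c : V, G.Adj a c ∧ G.Adj b c) :
    (GDel G {a, b}).Nonempty ∧ indepNumOn G (GDel G {a, b}) = indepNum G - 1 := by
  classical
  obtain ⟨c, hac, hbc⟩ := htri
  obtain ⟨v, hav, hbv⟩ := hloc.clawFree_compl.exists_common_neighbor h2.cliqueExchange_compl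
    (fun p q => WellCovered.exists_common_nonneighbor h2.2.1 hα)
    (fun W => eq_univ_of_not_isJoin hjoin) hab.ne (fun h => h.2 hab) hac.ne' hbc.ne'
    (fun h => h.2 hac) (fun h => h.2 hbc)
  have hv : v ∈ GDel G {a, b} := mem_GDel_pair.2 ⟨⟨hav.1.symm, hbv.1.symm⟩, hav.2, hbv.2⟩
  refine ⟨⟨v, hv⟩, ?_⟩
  have hins : ∀ T : Finset V, IsIndepOn G (GDel G {a, b}) ↑T →
      IsIndepOn G univ ↑(insert a T) ∧ (insert a T).card = T.card + 1 := by
    intro T hT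
    rw [Finset.coe_insert]
    exact ⟨IsIndepOn.insert ⟨subset_univ _, hT.2⟩ trivial
        fun s hs => (mem_GDel_pair.1 (hT.1 hs)).2.1,
      Finset.card_insert_of_notMem fun h => (mem_GDel_pair.1 (hT.1 h)).1.1 rfl⟩
  have hv1 : IsIndepOn G (GDel G {a, b}) ↑({v} : Finset V) := by
    rw [Finset.coe_singleton]
    refine ⟨singleton_subset_iff.2 hv, ?_⟩
    rintro x rfl y rfl
    exact G.irrefl
  obtain ⟨S, hvS, hS⟩ := hv1.exists_maxIndepOn
  have hne : S.Nonempty := ⟨v, hvS (Finset.mem_singleton_self v)⟩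
  have hmax : MaxIndepOn G univ (insert a S) := by
    refine ⟨(hins S hS.1).1, fun w _ hw hind => hw ?_⟩
    have hnadj : ∀ s ∈ insert a S, ¬ G.Adj w s := fun s hs =>
      hind.2 (mem_insert w _) (mem_insert_of_mem w hs)
    exact Finset.mem_insert_of_mem (mem_of_maxIndepOn_of_not_adj h2 hloc hab hS hne
      (by rintro rfl; exact hw (Finset.mem_insert_self w S))
      (fun s hs => hnadj s (Finset.mem_insert_of_mem hs)) (hnadj a (Finset.mem_insert_self a S)))
  have hcard : S.card + 1 = indepNum G := (hins S hS.1).2 ▸ h2.2.1 _ hmax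
  refine le_antisymm (csSup_le' ?_) ?_
  · rintro n ⟨T, hT, rfl⟩
    have h : (insert a T).card ≤ indepNum G := (hins T hT).1.card_le
    rw [(hins T hT).2] at h
    omega
  · have := hS.1.card_le
    omega
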